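/- arXiv:1406.0299 — 2 statements merged into one kernel-verified Lean document; each statement's English description precedes it below -/
import Mathlib

section
/- With B, C and E a regular separability idempotent with antipodal maps S_B, S_C as in the context, one has m_C((S_B ⊗ id_C)(E·(1 ⊗ c))) = c for every c ∈ C and m_B((id_B ⊗ S_C)((b ⊗ 1)·E)) = b for every b ∈ B, where m_B : B ⊗ B → B and m_C : C ⊗ C → C denote the multiplication maps. -/
open TensorProduct

/-- Slice map `id ⊗ ω` landing in the left tensor factor. -/
noncomputable def sL {B C : Type} [AddCommGroup B] [Module ℂ B] [AddCommGroup C] [Module ℂ C]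
    (ω : C →ₗ[ℂ] ℂ) : (B ⊗[ℂ] C) →ₗ[ℂ] B :=
  (TensorProduct.rid ℂ B).toLinearMap ∘ₗ LinearMap.lTensor B ω

/-- Slice map `ω ⊗ id` landing in the right tensor factor. -/
noncomputable def sR {B C : Type} [AddCommGroup B] [Module ℂ B] [AddCommGroup C] [Module ℂ C]
    (ω : B →ₗ[ℂ] ℂ) : (B ⊗[ℂ] C) →ₗ[ℂ] C :=
  (TensorProduct.lid ℂ C).toLinearMap ∘ₗ LinearMap.rTensor C ω

section

variable {B C : Type} [Ring B] [Algebra ℂ B] [Ring C] [Algebra ℂ C]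

theorem sR_mul_one_tmul (ω : B →ₗ[ℂ] ℂ) (T : B ⊗[ℂ] C) (c : C) :
    sR ω (T * ((1 : B) ⊗ₜ[ℂ] c)) = sR ω T * c := by
  induction T with
  | zero => simp
  | tmul b d => simp [sR]
  | add x y hx hy => simp only [add_mul, map_add, hx, hy]

theorem sL_tmul_one_mul (ω : C →ₗ[ℂ] ℂ) (T : B ⊗[ℂ] C) (b : B) :
    sL ω ((b ⊗ₜ[ℂ] (1 : C)) * T) = b * sL ω T := by
  induction T with
  | zero => simp
  | tmul a d => simp [sL]
  | add x y hx hy => simp only [mul_add, map_add, hx, hy]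

theorem mul'_map_left_mul_one_tmul (f : B →ₗ[ℂ] C) (T : B ⊗[ℂ] C) (c : C) :
    LinearMap.mul' ℂ C (TensorProduct.map f LinearMap.id (T * ((1 : B) ⊗ₜ[ℂ] c))) =
      LinearMap.mul' ℂ C (TensorProduct.map f LinearMap.id T) * c := by
  induction T with
  | zero => simp
  | tmul b d => simp [mul_assoc]
  | add x y hx hy => simp only [add_mul, map_add, hx, hy]

theorem mul'_map_right_tmul_one_mul (f : C →ₗ[ℂ] B) (T : B ⊗[ℂ] C) (b : B) :
    LinearMap.mul' ℂ B (TensorProduct.map LinearMap.id f ((b ⊗ₜ[ℂ] (1 : C)) * T)) =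
      b * LinearMap.mul' ℂ B (TensorProduct.map LinearMap.id f T) := by
  induction T with
  | zero => simp
  | tmul a d => simp [mul_assoc]
  | add x y hx hy => simp only [mul_add, map_add, hx, hy]

theorem mul_eq_mul_one_tmul_mul' {E : B ⊗[ℂ] C} {f : B →ₗ[ℂ] C}
    (hf : ∀ b : B, E * (b ⊗ₜ[ℂ] (1 : C)) = E * ((1 : B) ⊗ₜ[ℂ] f b)) (T : B ⊗[ℂ] C) :
    E * T = E * ((1 : B) ⊗ₜ[ℂ] LinearMap.mul' ℂ C (TensorProduct.map f LinearMap.id T)) := by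
  induction T with
  | zero => simp
  | tmul b c =>
    have hbc : b ⊗ₜ[ℂ] c = (b ⊗ₜ[ℂ] (1 : C)) * ((1 : B) ⊗ₜ[ℂ] c) := by simp
    rw [hbc, ← mul_assoc, hf, mul_assoc]
    simp
  | add x y hx hy => simp only [mul_add, map_add, TensorProduct.tmul_add, hx, hy]

theorem mul_eq_mul'_tmul_one_mul {E : B ⊗[ℂ] C} {f : C →ₗ[ℂ] B}
    (hf : ∀ c : C, ((1 : B) ⊗ₜ[ℂ] c) * E = (f c ⊗ₜ[ℂ] (1 : C)) * E) (T : B ⊗[ℂ] C) :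
    T * E = (LinearMap.mul' ℂ B (TensorProduct.map LinearMap.id f T) ⊗ₜ[ℂ] (1 : C)) * E := by
  induction T with
  | zero => simp
  | tmul b c =>
    have hbc : b ⊗ₜ[ℂ] c = (b ⊗ₜ[ℂ] (1 : C)) * ((1 : B) ⊗ₜ[ℂ] c) := by simp
    rw [hbc, mul_assoc, hf, ← mul_assoc]
    simp
  | add x y hx hy => simp only [add_mul, map_add, TensorProduct.add_tmul, hx, hy]

theorem eq_one_of_mul_one_tmul_eq {E : B ⊗[ℂ] C}
    (hfull : Submodule.span ℂ {y : C | ∃ ω : B →ₗ[ℂ] ℂ, y = sR ω E} = ⊤) {x : C}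
    (hx : E * ((1 : B) ⊗ₜ[ℂ] x) = E) : x = 1 := by
  have h : LinearMap.mulRight ℂ x = LinearMap.id := by
    refine LinearMap.ext_on hfull ?_
    rintro _ ⟨ω, rfl⟩
    simp [← sR_mul_one_tmul, hx]
  simpa using LinearMap.congr_fun h 1

theorem eq_one_of_tmul_one_mul_eq {E : B ⊗[ℂ] C}
    (hfull : Submodule.span ℂ {y : B | ∃ ω : C →ₗ[ℂ] ℂ, y = sL ω E} = ⊤) {x : B}
    (hx : (x ⊗ₜ[ℂ] (1 : C)) * E = E) : x = 1 := by
  have h : LinearMap.mulLeft ℂ x = LinearMap.id := by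
    refine LinearMap.ext_on hfull ?_
    rintro _ ⟨ω, rfl⟩
    simp [← sL_tmul_one_mul, hx]
  simpa using LinearMap.congr_fun h 1

end

theorem statement2
    (B C : Type) [Ring B] [Algebra ℂ B] [Ring C] [Algebra ℂ C]
    (E : B ⊗[ℂ] C) (hEE : E * E = E)
    (hfullB : Submodule.span ℂ {x : B | ∃ ω : C →ₗ[ℂ] ℂ, x = sL ω E} = ⊤)
    (hfullC : Submodule.span ℂ {y : C | ∃ ω : B →ₗ[ℂ] ℂ, y = sR ω E} = ⊤)
    (SB : B ≃ₗ[ℂ] C) (SC : C ≃ₗ[ℂ] B)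
    (hSBanti : ∀ b b' : B, SB (b * b') = SB b' * SB b)
    (hSCanti : ∀ c c' : C, SC (c * c') = SC c' * SC c)
    (hSBrel : ∀ b : B, E * (b ⊗ₜ[ℂ] (1 : C)) = E * ((1 : B) ⊗ₜ[ℂ] SB b))
    (hSCrel : ∀ c : C, ((1 : B) ⊗ₜ[ℂ] c) * E = (SC c ⊗ₜ[ℂ] (1 : C)) * E)
 :
    (∀ c : C, LinearMap.mul' ℂ C
        (TensorProduct.map SB.toLinearMap LinearMap.id (E * ((1 : B) ⊗ₜ[ℂ] c))) = c) ∧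
    (∀ b : B, LinearMap.mul' ℂ B
        (TensorProduct.map LinearMap.id SC.toLinearMap ((b ⊗ₜ[ℂ] (1 : C)) * E)) = b) := by
  refine ⟨fun c => ?_, fun b => ?_⟩
  · rw [mul'_map_left_mul_one_tmul, eq_one_of_mul_one_tmul_eq hfullC
      ((mul_eq_mul_one_tmul_mul' hSBrel E).symm.trans hEE), one_mul]
  · rw [mul'_map_right_tmul_one_mul, eq_one_of_tmul_one_mul_eq hfullB
      ((mul_eq_mul'_tmul_one_mul hSCrel E).symm.trans hEE), mul_one]
end

section
/- Under the standing hypotheses in the context, if φ is a left integral then for all a ∈ A: (id ⊗ φ)(Δ(a)) = (id ⊗ φ)(F₂·(1 ⊗ a)) = (id ⊗ φ)((1 ⊗ a)·F₄); and if ψ is a right integral then for all a ∈ A: (ψ ⊗ id)(Δ(a)) = (ψ ⊗ id)((a ⊗ 1)·F₁) = (ψ ⊗ id)(F₃·(a ⊗ 1)). -/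
open TensorProduct

/-- `u ⊗ v ↦ u ⊗ (v ⊗ 1)`, placing `A ⊗ A` in legs 1 and 2 of the triple tensor product. -/
noncomputable def leg12 (A : Type) [Ring A] [Algebra ℂ A] :
    (A ⊗[ℂ] A) →ₗ[ℂ] A ⊗[ℂ] (A ⊗[ℂ] A) :=
  TensorProduct.map LinearMap.id ((TensorProduct.mk ℂ A A).flip 1)

/-- `u ⊗ v ↦ u ⊗ (1 ⊗ v)`, placing `A ⊗ A` in legs 1 and 3 of the triple tensor product. -/
noncomputable def leg13 (A : Type) [Ring A] [Algebra ℂ A] :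
    (A ⊗[ℂ] A) →ₗ[ℂ] A ⊗[ℂ] (A ⊗[ℂ] A) :=
  TensorProduct.map LinearMap.id (TensorProduct.mk ℂ A A 1)

/-- A left integral: a nonzero functional with `(id ⊗ φ)(Δ a) ∈ C` for all `a`. -/
noncomputable def IsLeftIntegral (A : Type) [Ring A] [Algebra ℂ A] (Δ : A →ₗ[ℂ] A ⊗[ℂ] A)
    (C : Subalgebra ℂ A) (φ : A →ₗ[ℂ] ℂ) : Prop :=
  φ ≠ 0 ∧ ∀ a : A, sL φ (Δ a) ∈ C

/-- A right integral: a nonzero functional with `(ψ ⊗ id)(Δ a) ∈ B` for all `a`. -/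
noncomputable def IsRightIntegral (A : Type) [Ring A] [Algebra ℂ A] (Δ : A →ₗ[ℂ] A ⊗[ℂ] A)
    (B : Subalgebra ℂ A) (ψ : A →ₗ[ℂ] ℂ) : Prop :=
  ψ ≠ 0 ∧ ∀ a : A, sR ψ (Δ a) ∈ B

/-- There is a faithful set of left integrals. -/
noncomputable def FaithfulLeftIntegrals (A : Type) [Ring A] [Algebra ℂ A]
    (Δ : A →ₗ[ℂ] A ⊗[ℂ] A) (C : Subalgebra ℂ A) : Prop :=
  (∀ a : A, (∀ φ : A →ₗ[ℂ] ℂ, IsLeftIntegral A Δ C φ → ∀ b : A, φ (a * b) = 0) → a = 0) ∧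
  (∀ a : A, (∀ φ : A →ₗ[ℂ] ℂ, IsLeftIntegral A Δ C φ → ∀ b : A, φ (b * a) = 0) → a = 0)

/-- There is a faithful set of right integrals. -/
noncomputable def FaithfulRightIntegrals (A : Type) [Ring A] [Algebra ℂ A]
    (Δ : A →ₗ[ℂ] A ⊗[ℂ] A) (B : Subalgebra ℂ A) : Prop :=
  (∀ a : A, (∀ ψ : A →ₗ[ℂ] ℂ, IsRightIntegral A Δ B ψ → ∀ b : A, ψ (a * b) = 0) → a = 0) ∧
  (∀ a : A, (∀ ψ : A →ₗ[ℂ] ℂ, IsRightIntegral A Δ B ψ → ∀ b : A, ψ (b * a) = 0) → a = 0)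

/-- `F₁ = (id ⊗ S_C)(E)` viewed in `A ⊗ A`. -/
noncomputable def F1A (A : Type) [Ring A] [Algebra ℂ A] (B C : Subalgebra ℂ A)
    (E' : ↥B ⊗[ℂ] ↥C) (SC : ↥C ≃ₗ[ℂ] ↥B) : A ⊗[ℂ] A :=
  TensorProduct.map B.val.toLinearMap (B.val.toLinearMap ∘ₗ SC.toLinearMap) E'

/-- `F₂ = (S_B ⊗ id)(E)` viewed in `A ⊗ A`. -/
noncomputable def F2A (A : Type) [Ring A] [Algebra ℂ A] (B C : Subalgebra ℂ A)
    (E' : ↥B ⊗[ℂ] ↥C) (SB : ↥B ≃ₗ[ℂ] ↥C) : A ⊗[ℂ] A :=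
  TensorProduct.map (C.val.toLinearMap ∘ₗ SB.toLinearMap) C.val.toLinearMap E'

/-- `F₃ = (id ⊗ S_B⁻¹)(E)` viewed in `A ⊗ A`. -/
noncomputable def F3A (A : Type) [Ring A] [Algebra ℂ A] (B C : Subalgebra ℂ A)
    (E' : ↥B ⊗[ℂ] ↥C) (SB : ↥B ≃ₗ[ℂ] ↥C) : A ⊗[ℂ] A :=
  TensorProduct.map B.val.toLinearMap (B.val.toLinearMap ∘ₗ SB.symm.toLinearMap) E'

/-- `F₄ = (S_C⁻¹ ⊗ id)(E)` viewed in `A ⊗ A`. -/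
noncomputable def F4A (A : Type) [Ring A] [Algebra ℂ A] (B C : Subalgebra ℂ A)
    (E' : ↥B ⊗[ℂ] ↥C) (SC : ↥C ≃ₗ[ℂ] ↥B) : A ⊗[ℂ] A :=
  TensorProduct.map (C.val.toLinearMap ∘ₗ SC.symm.toLinearMap) C.val.toLinearMap E'

section Slices

variable {P Q : Type} [Ring P] [Algebra ℂ P] [Ring Q] [Algebra ℂ Q]

@[simp]
theorem sL_tmul {B C : Type} [AddCommGroup B] [Module ℂ B] [AddCommGroup C] [Module ℂ C]
    (ω : C →ₗ[ℂ] ℂ) (b : B) (c : C) : sL ω (b ⊗ₜ[ℂ] c) = ω c • b := by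
  simp [sL]

@[simp]
theorem sR_tmul {B C : Type} [AddCommGroup B] [Module ℂ B] [AddCommGroup C] [Module ℂ C]
    (ω : B →ₗ[ℂ] ℂ) (b : B) (c : C) : sR ω (b ⊗ₜ[ℂ] c) = ω b • c := by
  simp [sR]

theorem sL_tmul_one_mul_s9 (ω : Q →ₗ[ℂ] ℂ) (p : P) (y : P ⊗[ℂ] Q) :
    sL ω ((p ⊗ₜ[ℂ] (1 : Q)) * y) = p * sL ω y := by
  induction y with
  | zero => simp
  | tmul u v => simp
  | add u v hu hv => simp only [mul_add, map_add, hu, hv]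

theorem sL_mul_tmul_one (ω : Q →ₗ[ℂ] ℂ) (p : P) (y : P ⊗[ℂ] Q) :
    sL ω (y * (p ⊗ₜ[ℂ] (1 : Q))) = sL ω y * p := by
  induction y with
  | zero => simp
  | tmul u v => simp
  | add u v hu hv => simp only [add_mul, map_add, hu, hv]

theorem sR_one_tmul_mul (ω : P →ₗ[ℂ] ℂ) (q : Q) (y : P ⊗[ℂ] Q) :
    sR ω (((1 : P) ⊗ₜ[ℂ] q) * y) = q * sR ω y := by
  induction y with
  | zero => simp
  | tmul u v => simp
  | add u v hu hv => simp only [mul_add, map_add, hu, hv]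

theorem sR_mul_one_tmul_s9 (ω : P →ₗ[ℂ] ℂ) (q : Q) (y : P ⊗[ℂ] Q) :
    sR ω (y * ((1 : P) ⊗ₜ[ℂ] q)) = sR ω y * q := by
  induction y with
  | zero => simp
  | tmul u v => simp
  | add u v hu hv => simp only [add_mul, map_add, hu, hv]

theorem map_sR {A : Type} [AddCommGroup A] [Module ℂ A] (ω : P →ₗ[ℂ] ℂ) (T : Q →ₗ[ℂ] A)
    (y : P ⊗[ℂ] Q) : T (sR ω y) = sR ω (LinearMap.lTensor P T y) := by
  induction y with
  | zero => simp
  | tmul u v => simp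
  | add u v hu hv => simp only [map_add, hu, hv]

theorem map_sL {A : Type} [AddCommGroup A] [Module ℂ A] (ω : Q →ₗ[ℂ] ℂ) (T : P →ₗ[ℂ] A)
    (y : P ⊗[ℂ] Q) : T (sL ω y) = sL ω (LinearMap.rTensor Q T y) := by
  induction y with
  | zero => simp
  | tmul u v => simp
  | add u v hu hv => simp only [map_add, hu, hv]

theorem lTensor_sL_assoc_rTensor {A : Type} [Ring A] [Algebra ℂ A] (φ : A →ₗ[ℂ] ℂ)
    (Δ : A →ₗ[ℂ] A ⊗[ℂ] A) (y : A ⊗[ℂ] A) :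
    LinearMap.lTensor A (sL φ) (TensorProduct.assoc ℂ A A A (LinearMap.rTensor A Δ y)) =
      Δ (sL φ y) := by
  induction y with
  | zero => simp
  | tmul u v =>
    simp only [LinearMap.rTensor_tmul, sL_tmul, map_smul]
    induction Δ u with
    | zero => simp
    | tmul p q => simp
    | add p q hp hq => simp only [map_add, add_tmul, smul_add, hp, hq]
  | add u v hu hv => simp only [map_add, hu, hv]

theorem rTensor_sR_assoc_symm_lTensor {A : Type} [Ring A] [Algebra ℂ A] (ψ : A →ₗ[ℂ] ℂ)
    (Δ : A →ₗ[ℂ] A ⊗[ℂ] A) (y : A ⊗[ℂ] A) :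
    LinearMap.rTensor A (sR ψ) ((TensorProduct.assoc ℂ A A A).symm (LinearMap.lTensor A Δ y)) =
      Δ (sR ψ y) := by
  induction y with
  | zero => simp
  | tmul u v =>
    simp only [LinearMap.lTensor_tmul, sR_tmul, map_smul]
    induction Δ v with
    | zero => simp
    | tmul p q => simp [smul_tmul']
    | add p q hp hq => simp only [map_add, tmul_add, smul_add, hp, hq]
  | add u v hu hv => simp only [map_add, hu, hv]

end Slices

section Legs

variable {A : Type} [Ring A] [Algebra ℂ A]

theorem sR_leg12_mul (ω : A →ₗ[ℂ] ℂ) (x y : A ⊗[ℂ] A) :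
    sR ω (leg12 A x * ((1 : A) ⊗ₜ[ℂ] y)) = (sR ω x ⊗ₜ[ℂ] (1 : A)) * y := by
  induction x with
  | zero => simp
  | tmul u v => simp [leg12, ← smul_tmul']
  | add u v hu hv => simp only [add_mul, map_add, add_tmul, hu, hv]

theorem sR_mul_leg12 (ω : A →ₗ[ℂ] ℂ) (x y : A ⊗[ℂ] A) :
    sR ω (((1 : A) ⊗ₜ[ℂ] y) * leg12 A x) = y * (sR ω x ⊗ₜ[ℂ] (1 : A)) := by
  induction x with
  | zero => simp
  | tmul u v => simp [leg12, ← smul_tmul']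
  | add u v hu hv => simp only [mul_add, map_add, add_tmul, hu, hv]

theorem lTensor_sL_leg12_mul (ω : A →ₗ[ℂ] ℂ) (x y : A ⊗[ℂ] A) :
    LinearMap.lTensor A (sL ω) (leg12 A x * ((1 : A) ⊗ₜ[ℂ] y)) = x * ((1 : A) ⊗ₜ[ℂ] sL ω y) := by
  induction x with
  | zero => simp
  | tmul u v => simp [leg12, sL_tmul_one_mul_s9]
  | add u v hu hv => simp only [add_mul, map_add, hu, hv]

theorem lTensor_sL_mul_leg12 (ω : A →ₗ[ℂ] ℂ) (x y : A ⊗[ℂ] A) :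
    LinearMap.lTensor A (sL ω) (((1 : A) ⊗ₜ[ℂ] y) * leg12 A x) = ((1 : A) ⊗ₜ[ℂ] sL ω y) * x := by
  induction x with
  | zero => simp
  | tmul u v => simp [leg12, sL_mul_tmul_one]
  | add u v hu hv => simp only [mul_add, map_add, hu, hv]

end Legs

section SeparabilityIdempotent

variable {P Q : Type} [Ring P] [Algebra ℂ P] [Ring Q] [Algebra ℂ Q]

theorem map_one_of_antimul {f : P ≃ₗ[ℂ] Q} (hf : ∀ x y, f (x * y) = f y * f x) : f 1 = 1 := by
  have h := hf (f.symm 1) 1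
  simpa using h.symm

/-- A regular separability idempotent is fixed by the flip composed with its two
anti-isomorphisms. -/
theorem separability_flip {E : P ⊗[ℂ] Q} (hEE : E * E = E)
    (hfullL : Submodule.span ℂ {x : P | ∃ ω : Q →ₗ[ℂ] ℂ, x = sL ω E} = ⊤)
    (f : P ≃ₗ[ℂ] Q) (g : Q ≃ₗ[ℂ] P)
    (hf : ∀ b b', f (b * b') = f b' * f b) (hg : ∀ c c', g (c * c') = g c' * g c)
    (hfrel : ∀ b, E * (b ⊗ₜ[ℂ] (1 : Q)) = E * ((1 : P) ⊗ₜ[ℂ] f b))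
    (hgrel : ∀ c, ((1 : P) ⊗ₜ[ℂ] c) * E = (g c ⊗ₜ[ℂ] (1 : Q)) * E) :
    (TensorProduct.congr f g ≪≫ₗ TensorProduct.comm ℂ Q P) E = E := by
  set θ := TensorProduct.congr f g ≪≫ₗ TensorProduct.comm ℂ Q P with hθ
  have hθtmul (b : P) (c : Q) : θ (b ⊗ₜ c) = g c ⊗ₜ f b := by simp [hθ]
  have hθmul (b : P) (c : Q) (x : P ⊗[ℂ] Q) : θ (x * (b ⊗ₜ c)) = (g c ⊗ₜ f b) * θ x := by
    induction x with
    | zero => simp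
    | tmul u v => simp [hθtmul, hf, hg]
    | add u v hu hv => simp only [add_mul, map_add, mul_add, hu, hv]
  have hGrel (c : Q) : ((1 : P) ⊗ₜ[ℂ] c) * θ E = (g c ⊗ₜ[ℂ] (1 : Q)) * θ E := by
    have h := congrArg θ (hfrel (f.symm c))
    simpa [hθmul, map_one_of_antimul hf, map_one_of_antimul hg] using h
  obtain ⟨S, hS⟩ := TensorProduct.exists_finset E
  have key (y : P ⊗[ℂ] Q) (hy : ∀ c : Q, ((1 : P) ⊗ₜ[ℂ] c) * y = (g c ⊗ₜ[ℂ] (1 : Q)) * y) :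
      E * y = ((∑ i ∈ S, i.1 * g i.2) ⊗ₜ[ℂ] (1 : Q)) * y := by
    conv_lhs => rw [hS]
    rw [sum_tmul, Finset.sum_mul, Finset.sum_mul]
    refine Finset.sum_congr rfl fun i _ => ?_
    have h1 : i.1 ⊗ₜ[ℂ] i.2 = (i.1 ⊗ₜ[ℂ] (1 : Q)) * ((1 : P) ⊗ₜ[ℂ] i.2) := by simp
    rw [h1, mul_assoc, hy, ← mul_assoc]
    simp
  have hm : ∑ i ∈ S, i.1 * g i.2 = 1 := by
    have hb : ∀ x : P, (∑ i ∈ S, i.1 * g i.2) * x = x := by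
      intro x
      have hx : x ∈ Submodule.span ℂ {x : P | ∃ ω : Q →ₗ[ℂ] ℂ, x = sL ω E} := by
        rw [hfullL]; trivial
      induction hx using Submodule.span_induction with
      | mem x hx =>
        obtain ⟨ω, rfl⟩ := hx
        rw [← sL_tmul_one_mul_s9, ← key E hgrel, hEE]
      | zero => simp
      | add x y _ _ hx hy => rw [mul_add, hx, hy]
      | smul r x _ hx => rw [mul_smul_comm, hx]
    simpa using hb 1
  have h1 : E * θ E = θ E := by rw [key _ hGrel, hm, ← Algebra.TensorProduct.one_def, one_mul]
  have h2 : E * θ E = E := by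
    have h3 : θ E = ∑ i ∈ S, g i.2 ⊗ₜ[ℂ] f i.1 := by
      conv_lhs => rw [hS]
      simp [hθtmul]
    have h4 : ∀ i ∈ S, E * (g i.2 ⊗ₜ[ℂ] f i.1) = E * ((i.1 * g i.2) ⊗ₜ[ℂ] (1 : Q)) := by
      intro i _
      have h5 : g i.2 ⊗ₜ[ℂ] f i.1 = ((1 : P) ⊗ₜ[ℂ] f i.1) * (g i.2 ⊗ₜ[ℂ] (1 : Q)) := by simp
      rw [h5, ← mul_assoc, ← hfrel, mul_assoc]
      simp
    rw [h3, Finset.mul_sum, Finset.sum_congr rfl h4, ← Finset.mul_sum, ← sum_tmul, hm,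
      ← Algebra.TensorProduct.one_def, mul_one]
  exact h1.symm.trans h2

end SeparabilityIdempotent

section SliceFormulas

variable {A ι : Type} [Ring A] [Algebra ℂ A]

theorem lTensor_sL_eq_mul (S : Finset ι) (s t c : ι → A) (φ : A →ₗ[ℂ] ℂ) (T : A →ₗ[ℂ] A)
    (hT : ∀ a, T a = sL φ ((∑ i ∈ S, t i ⊗ₜ[ℂ] c i) * ((1 : A) ⊗ₜ[ℂ] a))) (y : A ⊗[ℂ] A)
    (hy : ∀ i ∈ S, ((1 : A) ⊗ₜ[ℂ] c i) * y = (s i ⊗ₜ[ℂ] (1 : A)) * y) :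
    LinearMap.lTensor A T y = (∑ i ∈ S, s i ⊗ₜ[ℂ] t i) * (sL φ y ⊗ₜ[ℂ] (1 : A)) := by
  have h : LinearMap.lTensor A T y = ∑ i ∈ S, sL φ (((1 : A) ⊗ₜ[ℂ] c i) * y) ⊗ₜ[ℂ] t i := by
    clear hy
    induction y with
    | zero => simp
    | tmul u v => simp [hT, Finset.sum_mul, tmul_sum, smul_tmul']
    | add u v hu hv => simp only [map_add, mul_add, add_tmul, Finset.sum_add_distrib, hu, hv]
  rw [h, Finset.sum_mul]
  refine Finset.sum_congr rfl fun i hi => ?_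
  rw [hy i hi, sL_tmul_one_mul_s9]
  simp

theorem lTensor_sL_eq_mul' (S : Finset ι) (s t c : ι → A) (φ : A →ₗ[ℂ] ℂ) (T : A →ₗ[ℂ] A)
    (hT : ∀ a, T a = sL φ (((1 : A) ⊗ₜ[ℂ] a) * ∑ i ∈ S, t i ⊗ₜ[ℂ] c i)) (y : A ⊗[ℂ] A)
    (hy : ∀ i ∈ S, y * ((1 : A) ⊗ₜ[ℂ] c i) = y * (s i ⊗ₜ[ℂ] (1 : A))) :
    LinearMap.lTensor A T y = (sL φ y ⊗ₜ[ℂ] (1 : A)) * ∑ i ∈ S, s i ⊗ₜ[ℂ] t i := by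
  have h : LinearMap.lTensor A T y = ∑ i ∈ S, sL φ (y * ((1 : A) ⊗ₜ[ℂ] c i)) ⊗ₜ[ℂ] t i := by
    clear hy
    induction y with
    | zero => simp
    | tmul u v => simp [hT, Finset.mul_sum, tmul_sum, smul_tmul']
    | add u v hu hv => simp only [map_add, add_mul, add_tmul, Finset.sum_add_distrib, hu, hv]
  rw [h, Finset.mul_sum]
  refine Finset.sum_congr rfl fun i hi => ?_
  rw [hy i hi, sL_mul_tmul_one]
  simp

theorem rTensor_sR_eq_mul (S : Finset ι) (s t b : ι → A) (ψ : A →ₗ[ℂ] ℂ) (T : A →ₗ[ℂ] A)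
    (hT : ∀ a, T a = sR ψ ((∑ i ∈ S, b i ⊗ₜ[ℂ] t i) * (a ⊗ₜ[ℂ] (1 : A)))) (y : A ⊗[ℂ] A)
    (hy : ∀ i ∈ S, (b i ⊗ₜ[ℂ] (1 : A)) * y = ((1 : A) ⊗ₜ[ℂ] s i) * y) :
    LinearMap.rTensor A T y = (∑ i ∈ S, t i ⊗ₜ[ℂ] s i) * ((1 : A) ⊗ₜ[ℂ] sR ψ y) := by
  have h : LinearMap.rTensor A T y = ∑ i ∈ S, t i ⊗ₜ[ℂ] sR ψ ((b i ⊗ₜ[ℂ] (1 : A)) * y) := by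
    clear hy
    induction y with
    | zero => simp
    | tmul u v => simp [hT, Finset.sum_mul, sum_tmul, smul_tmul']
    | add u v hu hv => simp only [map_add, mul_add, tmul_add, Finset.sum_add_distrib, hu, hv]
  rw [h, Finset.sum_mul]
  refine Finset.sum_congr rfl fun i hi => ?_
  rw [hy i hi, sR_one_tmul_mul]
  simp

theorem rTensor_sR_eq_mul' (S : Finset ι) (s t b : ι → A) (ψ : A →ₗ[ℂ] ℂ) (T : A →ₗ[ℂ] A)
    (hT : ∀ a, T a = sR ψ ((a ⊗ₜ[ℂ] (1 : A)) * ∑ i ∈ S, b i ⊗ₜ[ℂ] t i)) (y : A ⊗[ℂ] A)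
    (hy : ∀ i ∈ S, y * (b i ⊗ₜ[ℂ] (1 : A)) = y * ((1 : A) ⊗ₜ[ℂ] s i)) :
    LinearMap.rTensor A T y = ((1 : A) ⊗ₜ[ℂ] sR ψ y) * ∑ i ∈ S, t i ⊗ₜ[ℂ] s i := by
  have h : LinearMap.rTensor A T y = ∑ i ∈ S, t i ⊗ₜ[ℂ] sR ψ (y * (b i ⊗ₜ[ℂ] (1 : A))) := by
    clear hy
    induction y with
    | zero => simp
    | tmul u v => simp [hT, Finset.mul_sum, sum_tmul, smul_tmul']
    | add u v hu hv => simp only [map_add, add_mul, tmul_add, Finset.sum_add_distrib, hu, hv]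
  rw [h, Finset.mul_sum]
  refine Finset.sum_congr rfl fun i hi => ?_
  rw [hy i hi, sR_mul_one_tmul_s9]
  simp

end SliceFormulas

section Fullness

variable {A : Type} [Ring A] [Algebra ℂ A] {Δ : A →ₗ[ℂ] A ⊗[ℂ] A}

theorem eq_of_lTensor_comul_eq
    (hfull : Submodule.span ℂ {x : A | ∃ ω : A →ₗ[ℂ] ℂ, ∃ a : A, x = sR ω (Δ a)} = ⊤)
    {T T' : A →ₗ[ℂ] A} (h : ∀ a, LinearMap.lTensor A T (Δ a) = LinearMap.lTensor A T' (Δ a)) :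
    T = T' := by
  refine LinearMap.ext_on hfull ?_
  rintro _ ⟨ω, a, rfl⟩
  rw [map_sR, map_sR, h]

theorem eq_of_rTensor_comul_eq
    (hfull : Submodule.span ℂ {x : A | ∃ ω : A →ₗ[ℂ] ℂ, ∃ a : A, x = sL ω (Δ a)} = ⊤)
    {T T' : A →ₗ[ℂ] A} (h : ∀ a, LinearMap.rTensor A T (Δ a) = LinearMap.rTensor A T' (Δ a)) :
    T = T' := by
  refine LinearMap.ext_on hfull ?_
  rintro _ ⟨ω, a, rfl⟩
  rw [map_sL, map_sL, h]

end Fullness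

section ComulOnLegs

variable {A : Type} [Ring A] [Algebra ℂ A] {Δ : A →ₗ[ℂ] A ⊗[ℂ] A} {E : A ⊗[ℂ] A}
  {B C : Subalgebra ℂ A} {E' : ↥B ⊗[ℂ] ↥C}

theorem comul_one_eq (hΔmul : ∀ a a' : A, Δ (a * a') = Δ a * Δ a')
    (hEΔ : ∀ a : A, E * Δ a = Δ a ∧ Δ a * E = Δ a)
    (hranL : (Submodule.span ℂ {y : A ⊗[ℂ] A | ∃ a z, y = Δ a * z} : Set (A ⊗[ℂ] A)) =
      {y : A ⊗[ℂ] A | ∃ z, y = E * z}) : Δ 1 = E := by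
  have hE : E ∈ Submodule.span ℂ {y : A ⊗[ℂ] A | ∃ a z, y = Δ a * z} := by
    rw [← SetLike.mem_coe, hranL]
    exact ⟨1, (mul_one E).symm⟩
  have h : ∀ y ∈ Submodule.span ℂ {y : A ⊗[ℂ] A | ∃ a z, y = Δ a * z}, Δ 1 * y = y := by
    intro y hy
    induction hy using Submodule.span_induction with
    | mem x hx =>
      obtain ⟨a, z, rfl⟩ := hx
      rw [← mul_assoc, ← hΔmul, one_mul]
    | zero => simp
    | add x y _ _ hx hy => rw [mul_add, hx, hy]
    | smul r x _ hx => rw [mul_smul_comm, hx]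
  rw [← (hEΔ 1).2, h E hE]

theorem mem_span_sR_of_mem (hE'E : TensorProduct.map B.val.toLinearMap C.val.toLinearMap E' = E)
    (hfull : Submodule.span ℂ {y : ↥C | ∃ ω : ↥B →ₗ[ℂ] ℂ, y = sR ω E'} = ⊤)
    {c : A} (hc : c ∈ C) : c ∈ Submodule.span ℂ (Set.range fun ω : A →ₗ[ℂ] ℂ => sR ω E) := by
  have hmem : (⟨c, hc⟩ : C) ∈ Submodule.span ℂ {y : ↥C | ∃ ω : ↥B →ₗ[ℂ] ℂ, y = sR ω E'} := by
    rw [hfull]; trivial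
  have h := Submodule.mem_map_of_mem (f := C.val.toLinearMap) hmem
  rw [Submodule.map_span] at h
  refine Submodule.span_mono ?_ h
  rintro _ ⟨_, ⟨ω, rfl⟩, rfl⟩
  obtain ⟨ω', hω'⟩ := LinearMap.exists_extend (p := Subalgebra.toSubmodule B) ω
  have hω'' (b : B) : ω' (b : A) = ω b := LinearMap.congr_fun hω' b
  refine ⟨ω', ?_⟩
  rw [← hE'E]
  clear hE'E hfull hmem h
  dsimp only
  induction E' with
  | zero => simp
  | tmul u v => simp [hω'']
  | add u v hu hv => simp only [map_add, hu, hv]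

theorem mem_span_sL_of_mem (hE'E : TensorProduct.map B.val.toLinearMap C.val.toLinearMap E' = E)
    (hfull : Submodule.span ℂ {x : ↥B | ∃ ω : ↥C →ₗ[ℂ] ℂ, x = sL ω E'} = ⊤)
    {b : A} (hb : b ∈ B) : b ∈ Submodule.span ℂ (Set.range fun ω : A →ₗ[ℂ] ℂ => sL ω E) := by
  have hmem : (⟨b, hb⟩ : B) ∈ Submodule.span ℂ {x : ↥B | ∃ ω : ↥C →ₗ[ℂ] ℂ, x = sL ω E'} := by
    rw [hfull]; trivial
  have h := Submodule.mem_map_of_mem (f := B.val.toLinearMap) hmem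
  rw [Submodule.map_span] at h
  refine Submodule.span_mono ?_ h
  rintro _ ⟨_, ⟨ω, rfl⟩, rfl⟩
  obtain ⟨ω', hω'⟩ := LinearMap.exists_extend (p := Subalgebra.toSubmodule C) ω
  have hω'' (c : C) : ω' (c : A) = ω c := LinearMap.congr_fun hω' c
  refine ⟨ω', ?_⟩
  rw [← hE'E]
  clear hE'E hfull hmem h
  dsimp only
  induction E' with
  | zero => simp
  | tmul u v => simp [hω'']
  | add u v hu hv => simp only [map_add, hu, hv]

theorem comul_of_mem_span_sR
    (hΔE : LinearMap.lTensor A Δ E = leg12 A E * ((1 : A) ⊗ₜ[ℂ] E))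
    (hcomm : leg12 A E * ((1 : A) ⊗ₜ[ℂ] E) = ((1 : A) ⊗ₜ[ℂ] E) * leg12 A E)
    {c : A} (hc : c ∈ Submodule.span ℂ (Set.range fun ω : A →ₗ[ℂ] ℂ => sR ω E)) :
    Δ c = (c ⊗ₜ[ℂ] (1 : A)) * E ∧ Δ c = E * (c ⊗ₜ[ℂ] (1 : A)) := by
  induction hc using Submodule.span_induction with
  | mem x hx =>
    obtain ⟨ω, rfl⟩ := hx
    have h : Δ (sR ω E) = sR ω (LinearMap.lTensor A Δ E) := map_sR ω Δ E
    constructor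
    · rw [← sR_leg12_mul, ← hΔE, h]
    · rw [← sR_mul_leg12, ← hcomm, ← hΔE, h]
  | zero => simp
  | add x y _ _ hx hy =>
    exact ⟨by rw [map_add, add_tmul, add_mul, hx.1, hy.1],
      by rw [map_add, add_tmul, mul_add, hx.2, hy.2]⟩
  | smul r x _ hx =>
    exact ⟨by rw [map_smul, ← smul_tmul', smul_mul_assoc, hx.1],
      by rw [map_smul, ← smul_tmul', mul_smul_comm, hx.2]⟩

theorem comul_of_mem_span_sL
    (hΔE : TensorProduct.assoc ℂ A A A (LinearMap.rTensor A Δ E) =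
      leg12 A E * ((1 : A) ⊗ₜ[ℂ] E))
    (hcomm : leg12 A E * ((1 : A) ⊗ₜ[ℂ] E) = ((1 : A) ⊗ₜ[ℂ] E) * leg12 A E)
    {b : A} (hb : b ∈ Submodule.span ℂ (Set.range fun ω : A →ₗ[ℂ] ℂ => sL ω E)) :
    Δ b = ((1 : A) ⊗ₜ[ℂ] b) * E ∧ Δ b = E * ((1 : A) ⊗ₜ[ℂ] b) := by
  induction hb using Submodule.span_induction with
  | mem x hx =>
    obtain ⟨ω, rfl⟩ := hx
    have h := lTensor_sL_assoc_rTensor ω Δ E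
    constructor
    · rw [← lTensor_sL_mul_leg12, ← hcomm, ← hΔE, h]
    · rw [← lTensor_sL_leg12_mul, ← hΔE, h]
  | zero => simp
  | add x y _ _ hx hy =>
    exact ⟨by rw [map_add, tmul_add, add_mul, hx.1, hy.1],
      by rw [map_add, tmul_add, mul_add, hx.2, hy.2]⟩
  | smul r x _ hx =>
    exact ⟨by rw [map_smul, tmul_smul, smul_mul_assoc, hx.1],
      by rw [map_smul, tmul_smul, mul_smul_comm, hx.2]⟩

end ComulOnLegs

theorem statement9
    (A : Type) [Ring A] [Algebra ℂ A]
    (Δ : A →ₗ[ℂ] A ⊗[ℂ] A)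
    (hΔmul : ∀ a a' : A, Δ (a * a') = Δ a * Δ a')
    (hΔcoassoc : ∀ a : A,
      TensorProduct.assoc ℂ A A A (LinearMap.rTensor A Δ (Δ a)) = LinearMap.lTensor A Δ (Δ a))
    (hΔfullL : Submodule.span ℂ {x : A | ∃ ω : A →ₗ[ℂ] ℂ, ∃ a : A, x = sL ω (Δ a)} = ⊤)
    (hΔfullR : Submodule.span ℂ {x : A | ∃ ω : A →ₗ[ℂ] ℂ, ∃ a : A, x = sR ω (Δ a)} = ⊤)
    (E : A ⊗[ℂ] A)
    (hEE : E * E = E)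
    (hEΔ : ∀ a : A, E * Δ a = Δ a ∧ Δ a * E = Δ a)
    (hranL : (Submodule.span ℂ {y : A ⊗[ℂ] A | ∃ a z, y = Δ a * z} : Set (A ⊗[ℂ] A)) =
      {y : A ⊗[ℂ] A | ∃ z, y = E * z})
    (hranR : (Submodule.span ℂ {y : A ⊗[ℂ] A | ∃ a z, y = z * Δ a} : Set (A ⊗[ℂ] A)) =
      {y : A ⊗[ℂ] A | ∃ z, y = z * E})
    (hΔE1 : TensorProduct.assoc ℂ A A A (LinearMap.rTensor A Δ E) =
      leg12 A E * ((1 : A) ⊗ₜ[ℂ] E))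
    (hΔE2 : leg12 A E * ((1 : A) ⊗ₜ[ℂ] E) = ((1 : A) ⊗ₜ[ℂ] E) * leg12 A E)
    (B C : Subalgebra ℂ A)
    (E' : ↥B ⊗[ℂ] ↥C)
    (hE'E : TensorProduct.map B.val.toLinearMap C.val.toLinearMap E' = E)
    (hE'full1 : Submodule.span ℂ {x : ↥B | ∃ ω : ↥C →ₗ[ℂ] ℂ, x = sL ω E'} = ⊤)
    (hE'full2 : Submodule.span ℂ {y : ↥C | ∃ ω : ↥B →ₗ[ℂ] ℂ, y = sR ω E'} = ⊤)
    (SB : ↥B ≃ₗ[ℂ] ↥C) (SC : ↥C ≃ₗ[ℂ] ↥B)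
    (hSBanti : ∀ b b' : ↥B, SB (b * b') = SB b' * SB b)
    (hSCanti : ∀ c c' : ↥C, SC (c * c') = SC c' * SC c)
    (hSBrel : ∀ b : ↥B, E' * (b ⊗ₜ[ℂ] (1 : ↥C)) = E' * ((1 : ↥B) ⊗ₜ[ℂ] SB b))
    (hSCrel : ∀ c : ↥C, ((1 : ↥B) ⊗ₜ[ℂ] c) * E' = (SC c ⊗ₜ[ℂ] (1 : ↥C)) * E')
 :
    (∀ φ : A →ₗ[ℂ] ℂ, IsLeftIntegral A Δ C φ → ∀ a : A,
      sL φ (Δ a) = sL φ (F2A A B C E' SB * ((1 : A) ⊗ₜ[ℂ] a)) ∧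
      sL φ (Δ a) = sL φ (((1 : A) ⊗ₜ[ℂ] a) * F4A A B C E' SC)) ∧
    (∀ ψ : A →ₗ[ℂ] ℂ, IsRightIntegral A Δ B ψ → ∀ a : A,
      sR ψ (Δ a) = sR ψ ((a ⊗ₜ[ℂ] (1 : A)) * F1A A B C E' SC) ∧
      sR ψ (Δ a) = sR ψ (F3A A B C E' SB * (a ⊗ₜ[ℂ] (1 : A)))) := by
  have hΔ1 : Δ 1 = E := comul_one_eq hΔmul hEΔ hranL
  have hΔE1' : LinearMap.lTensor A Δ E = leg12 A E * ((1 : A) ⊗ₜ[ℂ] E) := by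
    rw [← hΔE1, ← hΔ1, hΔcoassoc]
  set j : ↥B ⊗[ℂ] ↥C →ₐ[ℂ] A ⊗[ℂ] A := Algebra.TensorProduct.map B.val C.val with hj
  have hjtmul (b : B) (c : C) : j (b ⊗ₜ c) = (b : A) ⊗ₜ[ℂ] (c : A) := by simp [hj]
  have hjE : j E' = E := hE'E
  have hjinj : Function.Injective j :=
    TensorProduct.map_injective_of_flat_flat B.val.toLinearMap C.val.toLinearMap
      Subtype.val_injective Subtype.val_injective
  have hEE' : E' * E' = E' := hjinj (by rw [map_mul, hjE, hEE])
  have hflip := separability_flip hEE' hE'full1 SB SC hSBanti hSCanti hSBrel hSCrel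
  have hflip' := (LinearEquiv.eq_symm_apply _).2 hflip
  obtain ⟨S, hS⟩ := TensorProduct.exists_finset E'
  have hG : ∑ i ∈ S, (SC i.2 : A) ⊗ₜ[ℂ] (SB i.1 : A) = E := by
    rw [← hjE, ← hflip, hS]
    simp [hjtmul]
  have hG' : ∑ i ∈ S, (SB.symm i.2 : A) ⊗ₜ[ℂ] (SC.symm i.1 : A) = E := by
    rw [← hjE, hflip', hS]
    simp [hjtmul]
  have hF1 : F1A A B C E' SC = ∑ i ∈ S, (i.1 : A) ⊗ₜ[ℂ] (SC i.2 : A) := by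
    rw [F1A, hS]; simp
  have hF2 : F2A A B C E' SB = ∑ i ∈ S, (SB i.1 : A) ⊗ₜ[ℂ] (i.2 : A) := by
    rw [F2A, hS]; simp
  have hF3 : F3A A B C E' SB = ∑ i ∈ S, (i.1 : A) ⊗ₜ[ℂ] (SB.symm i.2 : A) := by
    rw [F3A, hS]; simp
  have hF4 : F4A A B C E' SC = ∑ i ∈ S, (SC.symm i.1 : A) ⊗ₜ[ℂ] (i.2 : A) := by
    rw [F4A, hS]; simp
  have hB (b : B) : E * ((b : A) ⊗ₜ[ℂ] (1 : A)) = E * ((1 : A) ⊗ₜ[ℂ] (SB b : A)) := by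
    simpa [hjtmul, hjE] using congrArg j (hSBrel b)
  have hC (c : C) : ((1 : A) ⊗ₜ[ℂ] (c : A)) * E = ((SC c : A) ⊗ₜ[ℂ] (1 : A)) * E := by
    simpa [hjtmul, hjE] using congrArg j (hSCrel c)
  have left_mul {u v : A ⊗[ℂ] A} (h : u * E = v * E) (a : A) : u * Δ a = v * Δ a := by
    rw [← (hEΔ a).1, ← mul_assoc, h, mul_assoc]
  have right_mul {u v : A ⊗[ℂ] A} (h : E * u = E * v) (a : A) : Δ a * u = Δ a * v := by
    rw [← (hEΔ a).2, mul_assoc, h, mul_assoc]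
  refine ⟨fun φ hφ => ?_, fun ψ hψ => ?_⟩
  · have hT (a : A) : LinearMap.lTensor A (sL φ ∘ₗ Δ) (Δ a) = Δ (sL φ (Δ a)) := by
      rw [LinearMap.lTensor_comp, LinearMap.comp_apply, ← hΔcoassoc, lTensor_sL_assoc_rTensor]
    have hΔC (a : A) := comul_of_mem_span_sR hΔE1' hΔE2
      (mem_span_sR_of_mem hE'E hE'full2 (hφ.2 a))
    have h2 : sL φ ∘ₗ Δ = sL φ ∘ₗ LinearMap.mulLeft ℂ (F2A A B C E' SB) ∘ₗ
        TensorProduct.mk ℂ A A 1 := by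
      refine eq_of_lTensor_comul_eq hΔfullR fun a => ?_
      rw [hT, (hΔC a).2, lTensor_sL_eq_mul S (fun i => (SC i.2 : A)) (fun i => (SB i.1 : A))
        (fun i => (i.2 : A)) φ _ (fun a => by simp [hF2]) (Δ a)
        (fun i _ => left_mul (hC i.2) a), hG]
    have h4 : sL φ ∘ₗ Δ = sL φ ∘ₗ LinearMap.mulRight ℂ (F4A A B C E' SC) ∘ₗ
        TensorProduct.mk ℂ A A 1 := by
      refine eq_of_lTensor_comul_eq hΔfullR fun a => ?_
      rw [hT, (hΔC a).1, lTensor_sL_eq_mul' S (fun i => (SB.symm i.2 : A))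
        (fun i => (SC.symm i.1 : A)) (fun i => (i.2 : A)) φ _ (fun a => by simp [hF4]) (Δ a)
        (fun i _ => right_mul (by simpa using (hB (SB.symm i.2)).symm) a), hG']
    exact fun a => ⟨LinearMap.congr_fun h2 a, LinearMap.congr_fun h4 a⟩
  · have hT (a : A) : LinearMap.rTensor A (sR ψ ∘ₗ Δ) (Δ a) = Δ (sR ψ (Δ a)) := by
      rw [LinearMap.rTensor_comp, LinearMap.comp_apply, ← rTensor_sR_assoc_symm_lTensor,
        ← hΔcoassoc, LinearEquiv.symm_apply_apply]
    have hΔB (a : A) := comul_of_mem_span_sL hΔE1 hΔE2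
      (mem_span_sL_of_mem hE'E hE'full1 (hψ.2 a))
    have h1 : sR ψ ∘ₗ Δ = sR ψ ∘ₗ LinearMap.mulRight ℂ (F1A A B C E' SC) ∘ₗ
        (TensorProduct.mk ℂ A A).flip 1 := by
      refine eq_of_rTensor_comul_eq hΔfullL fun a => ?_
      rw [hT, (hΔB a).1, rTensor_sR_eq_mul' S (fun i => (SB i.1 : A)) (fun i => (SC i.2 : A))
        (fun i => (i.1 : A)) ψ _ (fun a => by simp [hF1]) (Δ a)
        (fun i _ => right_mul (hB i.1) a), hG]
    have h3 : sR ψ ∘ₗ Δ = sR ψ ∘ₗ LinearMap.mulLeft ℂ (F3A A B C E' SB) ∘ₗ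
        (TensorProduct.mk ℂ A A).flip 1 := by
      refine eq_of_rTensor_comul_eq hΔfullL fun a => ?_
      rw [hT, (hΔB a).2, rTensor_sR_eq_mul S (fun i => (SC.symm i.1 : A))
        (fun i => (SB.symm i.2 : A)) (fun i => (i.1 : A)) ψ _ (fun a => by simp [hF3]) (Δ a)
        (fun i _ => left_mul (by simpa using (hC (SC.symm i.1)).symm) a), hG']
    exact fun a => ⟨LinearMap.congr_fun h1 a, LinearMap.congr_fun h3 a⟩
end
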